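/- arXiv:2210.00459 — 2 statements merged into one kernel-verified Lean document; each statement's English description precedes it below -/
import Mathlib

section
/- Let G be a group and H ≤ G a coamenable subgroup, i.e. there exists a mean on ℓ∞(G/H) invariant under the G-action (g·f)(xH) = f(g⁻¹xH). Then for every n ≥ 1: every G-invariant bounded function f : G^{n+1} → ℝ with δⁿ f = 0 which equals δ^{n−1} h for some H-invariant bounded h : Gⁿ → ℝ also equals δ^{n−1} h' for some G-invariant bounded h' : Gⁿ → ℝ. In particular, if H is boundedly acyclic then so is G. -/
/-- A real-valued function is bounded. -/
def BddFn {α : Type*} (f : α → ℝ) : Prop := ∃ C : ℝ, ∀ x, |f x| ≤ C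

/-- A mean on `ℓ∞(X)`: a linear functional on the bounded real-valued functions on `X`
with `m(1) = 1` and `m(f) ≥ 0` whenever `f ≥ 0`.  (The value of `app` on unbounded
functions is irrelevant.) -/
structure Mean (X : Type*) where
  app : (X → ℝ) → ℝ
  map_add : ∀ f g : X → ℝ, BddFn f → BddFn g → app (f + g) = app f + app g
  map_smul : ∀ (c : ℝ) (f : X → ℝ), BddFn f → app (c • f) = c * app f
  map_one : app (fun _ => 1) = 1
  nonneg : ∀ f : X → ℝ, BddFn f → (∀ x, 0 ≤ f x) → 0 ≤ app f

/-- `G`-invariance of a cochain under the diagonal action. -/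
def GInvariant (G : Type*) [Group G] {n : ℕ} (f : (Fin n → G) → ℝ) : Prop :=
  ∀ (g : G) (x : Fin n → G), f (fun i => g * x i) = f x

/-- The simplicial coboundary. -/
def coboundary {G : Type*} (n : ℕ) (f : (Fin (n + 1) → G) → ℝ) :
    (Fin (n + 2) → G) → ℝ :=
  fun x => ∑ i : Fin (n + 2), (-1 : ℝ) ^ (i : ℕ) * f (x ∘ i.succAbove)

/-- `G` is boundedly acyclic. -/
def BoundedlyAcyclic (G : Type*) [Group G] : Prop :=
  ∀ (m : ℕ) (f : (Fin (m + 2) → G) → ℝ),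
    BddFn f → GInvariant G f → coboundary (m + 1) f = 0 →
    ∃ h : (Fin (m + 1) → G) → ℝ, BddFn h ∧ GInvariant G h ∧ coboundary m h = f

/-- Coboundary, allowing the augmentation degree. -/
def dd {G : Type*} {n : ℕ} (f : (Fin n → G) → ℝ) : (Fin (n + 1) → G) → ℝ :=
  fun x => ∑ i : Fin (n + 1), (-1 : ℝ) ^ (i : ℕ) * f (x ∘ i.succAbove)

/-- Freeze the first variable. -/
def fz {G : Type*} {n : ℕ} (f : (Fin (n + 1) → G) → ℝ) (a : G) : (Fin n → G) → ℝ :=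
  fun x => f (Fin.cons a x)

theorem comp_cons {G K : Type*} {n : ℕ} (p : G → K) (a : G) (x : Fin n → G) :
    p ∘ (Fin.cons a x : Fin (n + 1) → G) = Fin.cons (p a) (p ∘ x) := by
  funext i
  refine Fin.cases ?_ (fun j => ?_) i <;> simp

theorem dd_cons {G : Type*} {n : ℕ} (f : (Fin (n + 1) → G) → ℝ) (a : G) (x : Fin (n + 1) → G) :
    dd f (Fin.cons a x) = f x - dd (fz f a) x := by
  unfold dd fz
  rw [Fin.sum_univ_succ, sub_eq_add_neg, ← Finset.sum_neg_distrib]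
  congr 1
  · simp only [Fin.val_zero, pow_zero, one_mul]
    congr 1
  · refine Finset.sum_congr rfl fun i _ => ?_
    have : (Fin.cons a x : Fin (n + 2) → G) ∘ i.succ.succAbove
        = Fin.cons a (x ∘ i.succAbove) := by
      funext j
      refine Fin.cases ?_ (fun j => ?_) j <;> simp
    rw [this, Fin.val_succ, pow_succ]
    ring

theorem dd_comp {G K : Type*} {n : ℕ} (p : G → K) (f : (Fin n → K) → ℝ) (x : Fin (n + 1) → G) :
    dd (fun y => f (p ∘ y)) x = dd f (p ∘ x) := rfl

theorem dd_sub {G : Type*} {n : ℕ} (f g : (Fin n → G) → ℝ) (x : Fin (n + 1) → G) :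
    dd (fun y => f y - g y) x = dd f x - dd g x := by
  simp only [dd, ← Finset.sum_sub_distrib, mul_sub]

theorem dd_add {G : Type*} {n : ℕ} (f g : (Fin n → G) → ℝ) (x : Fin (n + 1) → G) :
    dd (fun y => f y + g y) x = dd f x + dd g x := by
  simp only [dd, ← Finset.sum_add_distrib, mul_add]

/-- The prism operator between the identity and `p`. -/
def prism {G : Type*} (p : G → G) : (n : ℕ) → ((Fin (n + 1) → G) → ℝ) → (Fin n → G) → ℝ
  | 0, _, _ => 0
  | n + 1, f, x => f (Fin.cons (x 0) (p ∘ x)) - prism p n (fz f (x 0)) (Fin.tail x)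

theorem prism_cons {G : Type*} (p : G → G) (n : ℕ) (f : (Fin (n + 2) → G) → ℝ) (a : G)
    (x : Fin n → G) : prism p (n + 1) f (Fin.cons a x)
      = f (Fin.cons a (Fin.cons (p a) (p ∘ x))) - prism p n (fz f a) x := by
  simp [prism, comp_cons]

theorem prism_sub {G : Type*} (p : G → G) (n : ℕ) (f g : (Fin (n + 1) → G) → ℝ)
    (x : Fin n → G) :
    prism p n (fun y => f y - g y) x = prism p n f x - prism p n g x := by
  induction n with
  | zero => simp [prism]
  | succ n ih =>
    simp only [prism]
    have : fz (fun y => f y - g y) (x 0) = fun y => fz f (x 0) y - fz g (x 0) y := rfl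
    rw [this, ih]
    ring

theorem prism_bdd {G : Type*} (p : G → G) (C : ℝ) (n : ℕ) (f : (Fin (n + 1) → G) → ℝ)
    (hf : ∀ x, |f x| ≤ C) (x : Fin n → G) : |prism p n f x| ≤ n * C := by
  induction n with
  | zero => simp [prism]
  | succ n ih =>
    simp only [prism]
    have h1 := ih (fz f (x 0)) (fun y => hf _) (Fin.tail x)
    have h2 := hf (Fin.cons (x 0) (p ∘ x))
    have h3 := abs_sub (f (Fin.cons (x 0) (p ∘ x))) (prism p n (fz f (x 0)) (Fin.tail x))
    push_cast
    linarith

theorem prism_equiv {G : Type*} (p q : G → G) (hp : ∀ x, p (q x) = q (p x)) (n : ℕ)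
    (f : (Fin (n + 1) → G) → ℝ) (x : Fin n → G) :
    prism p n f (q ∘ x) = prism p n (fun y => f (q ∘ y)) x := by
  induction n with
  | zero => simp [prism]
  | succ n ih =>
    simp only [prism]
    have h1 : p ∘ q ∘ x = q ∘ p ∘ x := by funext i; simp [hp]
    have h2 : fz (fun y => f (q ∘ y)) (x 0) = fun y => fz f (q (x 0)) (q ∘ y) := by
      funext y; simp [fz, comp_cons]
    rw [h2, ← ih, comp_cons, h1]
    rfl

theorem prism_homotopy {G : Type*} (p : G → G) (n : ℕ) (f : (Fin (n + 1) → G) → ℝ)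
    (x : Fin (n + 1) → G) :
    dd (prism p n f) x + prism p (n + 1) (dd f) x = f (p ∘ x) - f x := by
  induction n with
  | zero =>
    obtain ⟨a, y, rfl⟩ : ∃ a y, x = Fin.cons a y := ⟨x 0, Fin.tail x, by simp⟩
    rw [prism_cons, dd_cons, comp_cons]
    rw [Subsingleton.elim (p ∘ y) y]
    simp [dd, prism, fz]
  | succ n ih =>
    obtain ⟨a, y, rfl⟩ : ∃ a y, x = Fin.cons a y := ⟨x 0, Fin.tail x, by simp⟩
    rw [prism_cons, dd_cons, dd_cons, dd_cons, comp_cons]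
    have h1 : fz (prism p (n + 1) f) a
        = fun z => fz (fz f a) (p a) (p ∘ z) - prism p n (fz f a) z := by
      funext z; exact prism_cons p n f a z
    have h2 : fz (dd f) a = fun z => f z - dd (fz f a) z := by
      funext z; exact dd_cons f a z
    rw [h1, h2, dd_sub, prism_sub, dd_comp]
    have h3 := ih (fz f a) y
    have h4 : fz f a (p ∘ y) = f (Fin.cons a (p ∘ y)) := rfl
    have h5 : fz f a y = f (Fin.cons a y) := rfl
    linarith

theorem exists_equivariant {G : Type*} [Group G] (H : Subgroup G) :
    ∃ φ : G → H, ∀ (a : H) (g : G), φ (a * g) = a * φ g := by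
  let r : G → G := fun g =>
    (Quotient.mk (QuotientGroup.rightRel H) g).out
  have hr : ∀ g, g * (r g)⁻¹ ∈ H := fun g => by
    have := Quotient.mk_out (s := QuotientGroup.rightRel H) g
    exact QuotientGroup.rightRel_apply.mp this
  refine ⟨fun g => ⟨g * (r g)⁻¹, hr g⟩, fun a g => ?_⟩
  have h : r (a * g) = r g := by
    have : Quotient.mk (QuotientGroup.rightRel H) (a * g)
        = Quotient.mk (QuotientGroup.rightRel H) g := by
      apply Quotient.sound
      refine QuotientGroup.rightRel_apply.mpr ?_
      simp
    simp only [r, this]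
  ext
  simp [h, mul_assoc]

theorem BddFn.add' {α : Type*} {f g : α → ℝ} (hf : BddFn f) (hg : BddFn g) : BddFn (f + g) := by
  obtain ⟨C, hC⟩ := hf
  obtain ⟨D, hD⟩ := hg
  exact ⟨C + D, fun x => (abs_add_le _ _).trans (add_le_add (hC x) (hD x))⟩

theorem BddFn.smul' {α : Type*} {f : α → ℝ} (c : ℝ) (hf : BddFn f) : BddFn (c • f) := by
  obtain ⟨C, hC⟩ := hf
  refine ⟨|c| * C, fun x => ?_⟩
  simp only [Pi.smul_apply, smul_eq_mul, abs_mul]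
  exact mul_le_mul_of_nonneg_left (hC x) (abs_nonneg c)

theorem BddFn.const' {α : Type*} (c : ℝ) : BddFn (fun _ : α => c) := ⟨|c|, fun _ => le_rfl⟩

theorem Mean.const {X : Type*} (m : Mean X) (c : ℝ) : m.app (fun _ => c) = c := by
  have := m.map_smul c (fun _ => 1) (BddFn.const' 1)
  rw [m.map_one, mul_one] at this
  have h2 : (c • fun _ : X => (1 : ℝ)) = fun _ => c := by
    funext x
    simp
  rwa [h2] at this

theorem Mean.mono {X : Type*} (m : Mean X) {f g : X → ℝ} (hf : BddFn f) (hg : BddFn g)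
    (h : ∀ x, f x ≤ g x) : m.app f ≤ m.app g := by
  have h1 : BddFn (g + (-1 : ℝ) • f) := hg.add' (hf.smul' _)
  have h2 := m.nonneg _ h1 (fun x => by simpa using h x)
  rw [m.map_add _ _ hg (hf.smul' _), m.map_smul _ _ hf] at h2
  linarith

theorem Mean.abs_le {X : Type*} (m : Mean X) {f : X → ℝ} {C : ℝ} (hf : ∀ x, |f x| ≤ C) :
    |m.app f| ≤ C := by
  have hb : BddFn f := ⟨C, hf⟩
  refine _root_.abs_le.mpr ⟨?_, ?_⟩
  · have := m.mono (BddFn.const' (-C)) hb (fun x => (_root_.abs_le.mp (hf x)).1)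
    rwa [m.const] at this
  · have := m.mono hb (BddFn.const' C) (fun x => (_root_.abs_le.mp (hf x)).2)
    rwa [m.const] at this

theorem Mean.sum {X ι : Type*} (m : Mean X) (s : Finset ι) (c : ι → ℝ) (F : ι → X → ℝ)
    (hF : ∀ i, BddFn (F i)) :
    BddFn (fun x => ∑ i ∈ s, c i * F i x) ∧
    m.app (fun x => ∑ i ∈ s, c i * F i x) = ∑ i ∈ s, c i * m.app (F i) := by
  classical
  induction s using Finset.induction_on with
  | empty => simpa using ⟨BddFn.const' 0, m.const 0⟩
  | insert a s ha ih =>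
    have : (fun x => ∑ i ∈ insert a s, c i * F i x)
        = c a • F a + fun x => ∑ i ∈ s, c i * F i x := by
      funext x
      simp [Finset.sum_insert ha]
    rw [this, Finset.sum_insert ha, m.map_add _ _ ((hF a).smul' _) ih.1, m.map_smul _ _ (hF a), ih.2]
    exact ⟨((hF a).smul' _).add' ih.1, rfl⟩

theorem transfer_aux {G : Type*} [Group G] (H : Subgroup G)
    (hco : ∃ m : Mean (G ⧸ H), ∀ (g : G) (f : (G ⧸ H) → ℝ), BddFn f →
      m.app (fun x => f (g⁻¹ • x)) = m.app f)
    (n : ℕ) (f : (Fin (n + 2) → G) → ℝ) (hf : GInvariant G f)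
    (h : (Fin (n + 1) → G) → ℝ) (hb : BddFn h)
    (hinv : ∀ (a : ↥H) (x : Fin (n + 1) → G), h (fun i => (a : G) * x i) = h x)
    (hd : coboundary n h = f) :
    ∃ h' : (Fin (n + 1) → G) → ℝ, BddFn h' ∧ GInvariant G h' ∧ coboundary n h' = f := by
  obtain ⟨m, hm⟩ := hco
  obtain ⟨C, hC⟩ := hb
  let F : (Fin (n + 1) → G) → (G ⧸ H) → ℝ := fun x q =>
    Quotient.liftOn' q (fun g => h (fun i => g⁻¹ * x i)) (by
      intro g k hgk
      rw [QuotientGroup.leftRel_apply] at hgk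
      have := hinv ⟨g⁻¹ * k, hgk⟩ (fun i => k⁻¹ * x i)
      simpa [mul_assoc] using this)
  have hFm : ∀ x (g : G), F x (g : G ⧸ H) = h (fun i => g⁻¹ * x i) := fun x g => rfl
  have hFC : ∀ x q, |F x q| ≤ C := by
    intro x q
    induction q using QuotientGroup.induction_on with
    | H g => exact hC _
  refine ⟨fun x => m.app (F x), ⟨C, fun x => m.abs_le (hFC x)⟩, ?_, ?_⟩
  · intro k x
    change m.app _ = m.app (F x)
    rw [← hm k (F x) ⟨C, hFC x⟩]
    congr 1
    funext q
    induction q using QuotientGroup.induction_on with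
    | H g =>
      change F _ (g : G ⧸ H) = F x ((k⁻¹ * g : G) : G ⧸ H)
      rw [hFm, hFm]
      simp [mul_assoc]
  · funext x
    unfold coboundary
    rw [← (m.sum Finset.univ (fun i : Fin (n + 2) => (-1 : ℝ) ^ (i : ℕ))
      (fun i => F (x ∘ i.succAbove)) (fun i => ⟨C, hFC _⟩)).2]
    rw [← m.const (f x)]
    congr 1
    funext q
    induction q using QuotientGroup.induction_on with
    | H g =>
      rw [← hf g⁻¹ x, ← hd]
      rfl

theorem H_primitive {G : Type*} [Group G] (H : Subgroup G) (hH : BoundedlyAcyclic H)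
    (n : ℕ) (f : (Fin (n + 2) → G) → ℝ) (hb : BddFn f) (hf : GInvariant G f)
    (hc : coboundary (n + 1) f = 0) :
    ∃ h : (Fin (n + 1) → G) → ℝ, BddFn h ∧
        (∀ (a : ↥H) (x : Fin (n + 1) → G), h (fun i => (a : G) * x i) = h x) ∧
        coboundary n h = f := by
  obtain ⟨φ, hφ⟩ := exists_equivariant H
  obtain ⟨C, hC⟩ := hb
  let ι : H → G := fun a => a
  let p : G → G := ι ∘ φ
  obtain ⟨k, ⟨D, hD⟩, hkinv, hkd⟩ := hH n (fun x => f (ι ∘ x)) ⟨C, fun x => hC _⟩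
    (fun a x => hf a (ι ∘ x)) (by
      funext x
      exact congrFun hc (ι ∘ x))
  refine ⟨fun x => k (φ ∘ x) - prism p (n + 1) f x, ⟨D + (n + 1 : ℕ) * C, fun x => ?_⟩, ?_, ?_⟩
  · exact (abs_sub _ _).trans (add_le_add (hD _) (prism_bdd p C _ f hC x))
  · intro a x
    have h1 : φ ∘ (fun i => (a : G) * x i) = fun i => a * (φ ∘ x) i := by
      funext i; exact hφ a (x i)
    have h2 := prism_equiv p (fun g => (a : G) * g) (fun g => by simp [p, ι, hφ]) (n + 1) f x
    have h3 : (fun y : Fin (n + 2) → G => f ((fun g => (a : G) * g) ∘ y)) = f := by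
      funext y; exact hf a y
    rw [h3] at h2
    have h4 : prism p (n + 1) f (fun i => (a : G) * x i) = prism p (n + 1) f x := h2
    simp only [h1, h4]
    rw [hkinv a (φ ∘ x)]
  · funext x
    have h1 := prism_homotopy p (n + 1) f x
    have h0 : dd f = fun y => dd f y - dd f y := by
      simp only [sub_self]; exact hc
    rw [h0, prism_sub, sub_self, add_zero] at h1
    have h2 : dd k (φ ∘ x) = f (p ∘ x) := congrFun hkd (φ ∘ x)
    change dd (fun x => k (φ ∘ x) - prism p (n + 1) f x) x = f x
    rw [dd_sub, dd_comp, h1, h2]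
    ring

/-- Let `H ≤ G` be coamenable, i.e. there is a `G`-invariant mean on `ℓ∞(G/H)`.  Then for
every `n ≥ 1` (written `n = m + 1`): every `G`-invariant bounded cocycle `f : G^{n+1} → ℝ`
which is the coboundary of some `H`-invariant bounded cochain is also the coboundary of a
`G`-invariant bounded cochain.  In particular, if `H` is boundedly acyclic then so is `G`. -/
theorem coamenable_transfer {G : Type*} [Group G] (H : Subgroup G)
    (hco : ∃ m : Mean (G ⧸ H), ∀ (g : G) (f : (G ⧸ H) → ℝ), BddFn f →
      m.app (fun x => f (g⁻¹ • x)) = m.app f) :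
    (∀ (m : ℕ) (f : (Fin (m + 2) → G) → ℝ),
      BddFn f → GInvariant G f → coboundary (m + 1) f = 0 →
      (∃ h : (Fin (m + 1) → G) → ℝ, BddFn h ∧
        (∀ (a : ↥H) (x : Fin (m + 1) → G), h (fun i => (a : G) * x i) = h x) ∧
        coboundary m h = f) →
      ∃ h' : (Fin (m + 1) → G) → ℝ, BddFn h' ∧ GInvariant G h' ∧ coboundary m h' = f)
    ∧ (BoundedlyAcyclic ↥H → BoundedlyAcyclic G) := by
  refine ⟨fun m f _ hf _ ⟨h, hb, hinv, hd⟩ => transfer_aux H hco m f hf h hb hinv hd, ?_⟩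
  intro hH m f hb hf hc
  obtain ⟨h, hb', hinv, hd⟩ := H_primitive H hH m f hb hf hc
  exact transfer_aux H hco m f hf h hb' hinv hd
end

section
/- Let K be a Cantor set and let U, V be proper nonempty subsets of K, each both open and closed, with U ∩ V ≠ ∅. Then there exists a homeomorphism φ of K with φ(U) = V such that φ restricts to the identity on some nonempty open subset of U ∩ V. -/
open Filter Topology

lemma cantor_split {X : Type*} [TopologicalSpace X] [CompactSpace X] [T2Space X]
    [TotallyDisconnectedSpace X] (hX : ∀ x : X, ¬ IsOpen ({x} : Set X))
    (A : Set X) (hA : IsClopen A) (hne : A.Nonempty) :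
    ∃ P : Set X, IsClopen P ∧ P ⊆ A ∧ P.Nonempty ∧ (A \ P).Nonempty := by
  obtain ⟨x, hx⟩ := hne
  have : ∃ y ∈ A, y ≠ x := by
    by_contra! h
    apply hX x
    have : A = {x} := by
      ext y; constructor
      · intro hy; exact h y hy
      · rintro rfl; exact hx
    rw [← this]; exact hA.isOpen
  obtain ⟨y, hy, hyx⟩ := this
  obtain ⟨C, hC, hxC, hyC⟩ := exists_isClopen_of_totally_separated hyx.symm
  exact ⟨A ∩ C, hA.inter hC, Set.inter_subset_left, ⟨x, hx, hxC⟩, ⟨y, hy, fun h => hyC h.2⟩⟩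

lemma cantor_split' {X : Type*} [TopologicalSpace X] [CompactSpace X] [T2Space X]
    [TotallyDisconnectedSpace X] (hX : ∀ x : X, ¬ IsOpen ({x} : Set X))
    (A C : Set X) : ∃ P : Set X, IsClopen A → A.Nonempty → IsClopen C →
      IsClopen P ∧ P ⊆ A ∧ P.Nonempty ∧ (A \ P).Nonempty ∧
      (P ⊆ C ∨ P ⊆ Cᶜ) ∧ (A \ P ⊆ C ∨ A \ P ⊆ Cᶜ) := by
  by_cases h : IsClopen A ∧ A.Nonempty ∧ IsClopen C
  swap
  · exact ⟨∅, fun a b c => (h ⟨a, b, c⟩).elim⟩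
  obtain ⟨hA, hne, hC⟩ := h
  by_cases h1 : A ⊆ C
  · obtain ⟨P, p1, p2, p3, p4⟩ := cantor_split hX A hA hne
    exact ⟨P, fun _ _ _ => ⟨p1, p2, p3, p4, Or.inl (p2.trans h1),
      Or.inl (Set.diff_subset.trans h1)⟩⟩
  by_cases h2 : A ⊆ Cᶜ
  · obtain ⟨P, p1, p2, p3, p4⟩ := cantor_split hX A hA hne
    exact ⟨P, fun _ _ _ => ⟨p1, p2, p3, p4, Or.inr (p2.trans h2),
      Or.inr (Set.diff_subset.trans h2)⟩⟩
  refine ⟨A ∩ C, fun _ _ _ => ⟨hA.inter hC, Set.inter_subset_left, ?_, ?_,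
    Or.inl Set.inter_subset_right, Or.inr ?_⟩⟩
  · obtain ⟨x, hx, hxC⟩ := Set.not_subset.1 h2
    exact ⟨x, hx, not_not.1 hxC⟩
  · obtain ⟨x, hx, hxC⟩ := Set.not_subset.1 h1
    exact ⟨x, hx, fun h => hxC h.2⟩
  · rintro x ⟨hx, hx'⟩ hxC
    exact hx' ⟨hx, hxC⟩

/-- Brouwer's characterization of the Cantor space. -/
lemma cantor_brouwer {X : Type*} [TopologicalSpace X] [CompactSpace X] [T2Space X]
    [SecondCountableTopology X] [TotallyDisconnectedSpace X] [Nonempty X]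
    (hX : ∀ x : X, ¬ IsOpen ({x} : Set X)) : Nonempty (X ≃ₜ (ℕ → Bool)) := by
  classical
  have hcount : Countable (TopologicalSpace.Clopens X) :=
    TopologicalSpace.Clopens.countable_iff_secondCountable.2 inferInstance
  obtain ⟨E, hE⟩ := exists_surjective_nat (TopologicalSpace.Clopens X)
  choose p hp using cantor_split' hX
  let D : List Bool → Set X := fun l => List.rec Set.univ
    (fun b t A => if b then p A (E t.length) else A \ p A (E t.length)) l
  have D0 : D [] = Set.univ := rfl
  have Dt : ∀ l, D (true :: l) = p (D l) (E l.length) := fun l => rfl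
  have Df : ∀ l, D (false :: l) = D l \ p (D l) (E l.length) := fun l => rfl
  have Dgood : ∀ l, IsClopen (D l) ∧ (D l).Nonempty := by
    intro l
    induction l with
    | nil => exact ⟨isClopen_univ, Set.univ_nonempty⟩
    | cons b l ih =>
      obtain ⟨p1, p2, p3, p4, -⟩ := hp (D l) (E l.length) ih.1 ih.2 (E l.length).isClopen
      cases b
      · rw [Df]; exact ⟨ih.1.diff p1, p4⟩
      · rw [Dt]; exact ⟨p1, p3⟩
  have Dsub : ∀ b l, D (b :: l) ⊆ D l := by
    intro b l
    obtain ⟨p1, p2, -⟩ := hp (D l) (E l.length) (Dgood l).1 (Dgood l).2 (E l.length).isClopen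
    cases b
    · rw [Df]; exact Set.diff_subset
    · rw [Dt]; exact p2
  have Ddec : ∀ b l, D (b :: l) ⊆ E l.length ∨ D (b :: l) ⊆ (E l.length : Set X)ᶜ := by
    intro b l
    obtain ⟨-, -, -, -, p5, p6⟩ :=
      hp (D l) (E l.length) (Dgood l).1 (Dgood l).2 (E l.length).isClopen
    cases b
    · rw [Df]; exact p6
    · rw [Dt]; exact p5
  let g : X → ℕ → List Bool := fun x n =>
    Nat.rec [] (fun _ l => decide (x ∈ D (true :: l)) :: l) n
  have g0 : ∀ x, g x 0 = [] := fun x => rfl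
  have gs : ∀ x n, g x (n+1) = decide (x ∈ D (true :: g x n)) :: g x n := fun x n => rfl
  have glen : ∀ x n, (g x n).length = n := by
    intro x n
    induction n with
    | zero => rfl
    | succ n ih => rw [gs, List.length_cons, ih]
  have gmem : ∀ x n, x ∈ D (g x n) := by
    intro x n
    induction n with
    | zero => trivial
    | succ n ih =>
      rw [gs]
      by_cases h : x ∈ D (true :: g x n)
      · simpa only [h, decide_true] using h
      · simp only [h, decide_false]
        rw [Df]; exact ⟨ih, h⟩
  have guniq : ∀ x l, x ∈ D l → g x l.length = l := by
    intro x l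
    induction l with
    | nil => intro _; rfl
    | cons b l ih =>
      intro hx
      rw [List.length_cons, gs, ih (Dsub b l hx)]
      congr 1
      cases b
      · rw [Df] at hx
        exact decide_eq_false hx.2
      · exact decide_eq_true hx
  let f : X → ℕ → Bool := fun x n => decide (x ∈ D (true :: g x n))
  have fdef : ∀ x n, f x n = decide (x ∈ D (true :: g x n)) := fun _ _ => rfl
  have gs' : ∀ x n, g x (n+1) = f x n :: g x n := fun x n => rfl
  clear_value f g
  have fcont : Continuous f := by
    refine continuous_pi fun n => ?_
    refine ((IsLocallyConstant.iff_exists_open _).2 fun x => ?_).continuous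
    refine ⟨D (g x (n+1)), (Dgood _).1.isOpen, gmem x (n+1), fun y hy => ?_⟩
    have h := guniq y _ hy
    rw [glen, gs', gs'] at h
    exact (List.cons.inj h).1
  have finj : Function.Injective f := by
    intro x y hxy
    by_contra hne
    have hg : ∀ n, g x n = g y n := by
      intro n
      induction n with
      | zero => rw [g0, g0]
      | succ n ih => rw [gs', gs', ih, hxy]
    obtain ⟨C, hC, hxC, hyC⟩ := exists_isClopen_of_totally_separated hne
    obtain ⟨n, hn⟩ := hE ⟨C, hC⟩
    have hx := gmem x (n+1)
    have hy := gmem y (n+1)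
    rw [← hg (n+1)] at hy
    rw [gs'] at hx hy
    have h := Ddec (f x n) (g x n)
    rw [glen, hn] at h
    rcases h with h | h
    · exact hyC (h hy)
    · exact (h hx) hxC
  have fsurj : Function.Surjective f := by
    intro s
    let r : ℕ → List Bool := fun n => Nat.rec [] (fun k l => s k :: l) n
    have rs : ∀ n, r (n+1) = s n :: r n := fun n => rfl
    have rlen : ∀ n, (r n).length = n := by
      intro n
      induction n with
      | zero => rfl
      | succ n ih => rw [rs, List.length_cons, ih]
    obtain ⟨x, hx⟩ := IsCompact.nonempty_iInter_of_sequence_nonempty_isCompact_isClosed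
      (fun n => D (r n)) (fun n => Dsub _ _) (fun n => (Dgood _).2)
      (Dgood (r 0)).1.isClosed.isCompact (fun n => (Dgood (r n)).1.isClosed)
    rw [Set.mem_iInter] at hx
    refine ⟨x, funext fun n => ?_⟩
    have h := guniq x (r (n+1)) (hx (n+1))
    rw [rlen (n+1), gs', rs] at h
    exact (List.cons.inj h).1
  exact ⟨Continuous.homeoOfEquivCompactToT2 (f := Equiv.ofBijective f ⟨finj, fsurj⟩) fcont⟩

lemma cantor_clopen {K : Type*} [TopologicalSpace K] [CompactSpace K] [T2Space K]
    [SecondCountableTopology K] [TotallyDisconnectedSpace K]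
    (hK : ∀ x : K, ¬ IsOpen ({x} : Set K)) (A : Set K) (hA : IsClopen A) (hne : A.Nonempty) :
    Nonempty (A ≃ₜ (ℕ → Bool)) := by
  haveI : CompactSpace A := isCompact_iff_compactSpace.1 hA.isClosed.isCompact
  haveI : Nonempty A := hne.to_subtype
  refine cantor_brouwer fun x hx => hK x ?_
  have := hA.isOpen.isOpenMap_subtype_val _ hx
  simpa using this

lemma cantor_bijOn {K : Type*} [TopologicalSpace K] [CompactSpace K] [T2Space K]
    [SecondCountableTopology K] [TotallyDisconnectedSpace K]
    (hK : ∀ x : K, ¬ IsOpen ({x} : Set K)) (A B : Set K) (hA : IsClopen A) (hB : IsClopen B)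
    (hAne : A.Nonempty) (hBne : B.Nonempty) :
    ∃ f : K → K, ContinuousOn f A ∧ Set.BijOn f A B := by
  classical
  obtain ⟨a⟩ := cantor_clopen hK A hA hAne
  obtain ⟨b⟩ := cantor_clopen hK B hB hBne
  let e : A ≃ₜ B := a.trans b.symm
  have key : ∀ x (h : x ∈ A), (fun x => if h : x ∈ A then (e ⟨x, h⟩ : K) else x) x = e ⟨x, h⟩ :=
    fun x h => dif_pos h
  refine ⟨fun x => if h : x ∈ A then (e ⟨x, h⟩ : K) else x, ?_, ?_, ?_, ?_⟩
  · rw [continuousOn_iff_continuous_restrict]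
    refine (continuous_subtype_val.comp e.continuous).congr fun x => ?_
    exact (key x x.2).symm
  · intro x hx
    rw [key x hx]; exact (e ⟨x, hx⟩).2
  · intro x hx y hy h
    rw [key x hx, key y hy] at h
    exact congrArg Subtype.val (e.injective (Subtype.ext h))
  · intro y hy
    refine ⟨e.symm ⟨y, hy⟩, (e.symm ⟨y, hy⟩).2, ?_⟩
    rw [key _ (e.symm ⟨y, hy⟩).2]
    simp

/-- Let `U`, `V` be proper nonempty clopen subsets of a Cantor set `K` with
`U ∩ V ≠ ∅`.  Then there is a homeomorphism `φ` of `K` mapping `U` onto `V` which is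
the identity on some nonempty open subset of `U ∩ V`. -/
theorem clopen_exchange_homeo {K : Type*} [TopologicalSpace K] [CompactSpace K]
    [TopologicalSpace.MetrizableSpace K] [TotallyDisconnectedSpace K] [Nonempty K]
    (hperf : ∀ x : K, (𝓝[≠] x).NeBot)
    (U V : Set K) (hUne : U.Nonempty) (hVne : V.Nonempty)
    (hUproper : U ≠ Set.univ) (hVproper : V ≠ Set.univ)
    (hUo : IsOpen U) (hUc : IsClosed U) (hVo : IsOpen V) (hVc : IsClosed V)
    (hUV : (U ∩ V).Nonempty) :
    ∃ φ : K ≃ₜ K, φ '' U = V ∧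
      ∃ W : Set K, W.Nonempty ∧ IsOpen W ∧ W ⊆ U ∩ V ∧ ∀ x ∈ W, φ x = x := by
  classical
  letI := TopologicalSpace.metrizableSpaceMetric K
  haveI : SecondCountableTopology K := inferInstance
  have hK : ∀ x : K, ¬ IsOpen ({x} : Set K) := by
    intro x hx
    exact (hperf x).ne (isOpen_singleton_iff_punctured_nhds x |>.1 hx)
  have hU : IsClopen U := ⟨hUc, hUo⟩
  have hV : IsClopen V := ⟨hVc, hVo⟩
  obtain ⟨W, hW, hWsub, hWne, z, hz, hzW⟩ := cantor_split hK (U ∩ V) (hU.inter hV) hUV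
  have hWU : W ⊆ U := fun x hx => (hWsub hx).1
  have hWV : W ⊆ V := fun x hx => (hWsub hx).2
  obtain ⟨f, hfc, hfb⟩ := cantor_bijOn hK (U \ W) (V \ W) (hU.diff hW) (hV.diff hW)
    ⟨z, hz.1, hzW⟩ ⟨z, hz.2, hzW⟩
  obtain ⟨k, hkc, hkb⟩ := cantor_bijOn hK Uᶜ Vᶜ hU.compl hV.compl
    (Set.nonempty_compl.2 hUproper) (Set.nonempty_compl.2 hVproper)
  let F : K → K := fun x => if x ∈ W then x else if x ∈ U then f x else k x
  have F1 : Set.EqOn F id W := fun x hx => if_pos hx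
  have F2 : Set.EqOn F f (U \ W) := fun x hx => by simp [F, hx.1, hx.2]
  have F3 : Set.EqOn F k Uᶜ := fun x hx => by
    have h1 : x ∉ U := hx
    have h2 : x ∉ W := fun h => h1 (hWU h)
    simp [F, h1, h2]
  have B1 : Set.BijOn F W W := (Set.bijOn_id W).congr F1.symm
  have B2 : Set.BijOn F (U \ W) (V \ W) := hfb.congr F2.symm
  have B3 : Set.BijOn F Uᶜ Vᶜ := hkb.congr F3.symm
  have inj : ∀ {A A' C C' : Set K}, Set.BijOn F A A' → Set.BijOn F C C' → Disjoint A' C' →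
      Set.InjOn F (A ∪ C) := by
    intro A A' C C' h1 h2 hd x hx y hy hxy
    rcases hx with hx | hx <;> rcases hy with hy | hy
    · exact h1.injOn hx hy hxy
    · exact (Set.disjoint_left.1 hd (h1.mapsTo hx) (hxy ▸ h2.mapsTo hy)).elim
    · exact (Set.disjoint_left.1 hd (h1.mapsTo hy) (hxy ▸ h2.mapsTo hx)).elim
    · exact h2.injOn hx hy hxy
  have B4 : Set.BijOn F U V := by
    have := B1.union B2 (inj B1 B2 Set.disjoint_sdiff_right)
    rwa [Set.union_diff_cancel hWU, Set.union_diff_cancel hWV] at this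
  have B5 : Function.Bijective F := by
    have := B4.union B3 (inj B4 B3 disjoint_compl_right)
    rw [Set.union_compl_self, Set.union_compl_self] at this
    exact Set.bijOn_univ.1 this
  have Fc : Continuous F := by
    rw [continuous_iff_continuousAt]
    intro x
    by_cases hxW : x ∈ W
    · exact (continuousOn_id.congr F1).continuousAt (hW.isOpen.mem_nhds hxW)
    by_cases hxU : x ∈ U
    · exact (hfc.congr F2).continuousAt ((hU.diff hW).isOpen.mem_nhds ⟨hxU, hxW⟩)
    · exact (hkc.congr F3).continuousAt (hU.compl.isOpen.mem_nhds hxU)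
  refine ⟨Continuous.homeoOfEquivCompactToT2 (f := Equiv.ofBijective F B5) Fc, B4.image_eq,
    W, hWne, hW.isOpen, hWsub, fun x hx => F1 hx⟩
end
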